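/- arXiv:2504.09239 — 6 statements merged into one kernel-verified Lean document; each statement's English description precedes it below -/
import Mathlib

section
/- In L = ℤ_p[G] there exist an element e ∈ L and a scalar α ∈ ℤ_p such that p·1 = e·(g−1)^(p−1) + α·N. (This is the group-ring form of the classical identity p = ε(ζ−1)^(p−1) with ε a unit of ℤ_p[ζ_p].) -/
noncomputable section

/-- The group algebra `ℤ_p[G]` for `G` cyclic of order `p`. -/
abbrev L (p : ℕ) [Fact p.Prime] : Type := MonoidAlgebra (PadicInt p) (Multiplicative (ZMod p))

/-- The fixed generator `g` of `G`, viewed inside `L = ℤ_p[G]`. -/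
def gL (p : ℕ) [Fact p.Prime] : L p :=
  MonoidAlgebra.of (PadicInt p) (Multiplicative (ZMod p)) (Multiplicative.ofAdd 1)

/-- The norm element `N = 1 + g + ⋯ + g^(p-1)` of `L`. -/
def NL (p : ℕ) [Fact p.Prime] : L p := ∑ i ∈ Finset.range p, gL p ^ i

open Polynomial in
theorem aux_poly (p : ℕ) [hp : Fact p.Prime] :
    ∃ w : ℤ[X], ∑ i ∈ Finset.range p, (X : ℤ[X]) ^ i - (X - 1) ^ (p - 1)
      = C (p : ℤ) * (1 + (X - 1) * w) := by
  have h1 : C (p : ℤ) ∣ ∑ i ∈ Finset.range p, (X : ℤ[X]) ^ i - (X - 1) ^ (p - 1) := by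
    rw [C_dvd_iff_dvd_coeff]
    intro n
    rw [← ZMod.intCast_zmod_eq_zero_iff_dvd, ← eq_intCast (Int.castRingHom (ZMod p)), ← coeff_map]
    have : (∑ i ∈ Finset.range p, (X : ℤ[X]) ^ i - (X - 1) ^ (p - 1)).map
        (Int.castRingHom (ZMod p)) = 0 := by
      have hx : (X - 1 : (ZMod p)[X]) ≠ 0 := by
        simpa using X_sub_C_ne_zero (1 : ZMod p)
      apply mul_right_cancel₀ hx
      simp only [Polynomial.map_sub, Polynomial.map_pow, Polynomial.map_sum, map_X,
        Polynomial.map_one, sub_mul, zero_mul]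
      rw [geom_sum_mul, ← pow_succ, Nat.sub_add_cancel hp.out.one_le, sub_pow_char]
      simp
    rw [this, coeff_zero]
  obtain ⟨q, hq⟩ := h1
  have h2 : q.eval 1 = 1 := by
    have := congrArg (eval 1) hq
    have h0 : p - 1 ≠ 0 := by have := hp.out.two_le; omega
    have hp0 : (p : ℤ) ≠ 0 := by exact_mod_cast hp.out.ne_zero
    simp [eval_finsetSum, h0] at this
    simpa [hp0, hp.out.ne_zero] using this
  have h3 : (X - C 1) ∣ q - 1 := by
    rw [dvd_iff_isRoot]; simp [h2]
  obtain ⟨w, hw⟩ := h3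
  refine ⟨w, ?_⟩
  rw [hq, ← map_one (C : ℤ →+* ℤ[X])]
  rw [← hw]; simp

/-- in `L = ℤ_p[G]` there exist `e ∈ L` and `α ∈ ℤ_p` with
`p·1 = e·(g−1)^(p−1) + α·N`. -/
theorem stmt_1 (p : ℕ) [Fact p.Prime] :
    ∃ (e : L p) (α : PadicInt p),
      (p : L p) = e * (gL p - 1) ^ (p - 1) + α • NL p := by
  obtain ⟨w, hw⟩ := aux_poly p
  have h := congrArg (Polynomial.aeval (gL p)) hw
  simp only [map_sub, map_sum, map_pow, Polynomial.aeval_X, map_mul, map_add, map_one,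
    map_natCast] at h
  have hg : gL p ^ p = 1 := by
    rw [gL, ← map_pow, ← ofAdd_nsmul]
    simp [MonoidAlgebra.one_def]
  have hN : NL p * (gL p - 1) = 0 := by
    rw [NL, geom_sum_mul, hg, sub_self]
  change NL p - _ = _ at h
  set v := Polynomial.aeval (gL p) w
  obtain ⟨m, hm⟩ : ∃ m, p - 1 = m + 1 :=
    ⟨p - 2, by have := (Fact.out : p.Prime).two_le; omega⟩
  rw [hm] at h ⊢
  set x := gL p - 1
  set N := NL p
  have hs := geom_sum_mul (-(x * v)) (m + 1)
  have hNs : N * ∑ i ∈ Finset.range (m + 1), (-(x * v)) ^ i = N := by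
    rw [Finset.sum_range_succ', mul_add, Finset.mul_sum, Finset.sum_eq_zero]
    · simp
    · intro i _
      rw [pow_succ]
      linear_combination (-(-(x * v)) ^ i * v) * hN
  set s := ∑ i ∈ Finset.range (m + 1), (-(x * v)) ^ i
  refine ⟨(p : L p) * (-v) ^ (m + 1) - s, 1, ?_⟩
  rw [one_smul]
  have h5 : (-(x * v)) ^ (m + 1) = (-v) ^ (m + 1) * x ^ (m + 1) := by
    rw [← mul_pow]; congr 1; ring
  rw [h5] at hs
  linear_combination (p : L p) * hs + hNs - s * h
end
end

section
/- Let e ∈ L be a norm-lift, i.e. p·1 − e·(g−1)^(p−1) ∈ ℤ_p·N. Then for every integer j ≥ 1 the identity N·p^j = p^(j+1)·1 − e^(j+1)·(g−1)^((j+1)(p−1)) holds in L. (Consequently, for every ℤ_p[G]-module A and every a ∈ A with b = (g−1)a, one has N·p^j·a = p^(j+1)·a − e^(j+1)·(g−1)^((j+1)(p−1)−1)·b.) -/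
noncomputable section

/-- `e ∈ L` is a norm-lift if `p·1 = e·(g−1)^(p−1) + α·N` for some `α ∈ ℤ_p`. -/
def IsNormLift (p : ℕ) [Fact p.Prime] (e : L p) : Prop :=
  ∃ α : PadicInt p, (p : L p) = e * (gL p - 1) ^ (p - 1) + α • NL p

theorem aux_gL_pow (p : ℕ) [Fact p.Prime] : gL p ^ p = 1 := by
  unfold gL
  rw [← map_pow, ← ofAdd_nsmul]
  simp [MonoidAlgebra.one_def]

theorem aux_NL_mul (p : ℕ) [Fact p.Prime] : NL p * (gL p - 1) = 0 := by
  unfold NL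
  rw [geom_sum_mul, aux_gL_pow, sub_self]

theorem aux_normLift (p : ℕ) [Fact p.Prime] (e : L p) (he : IsNormLift p e) :
    (p : L p) = e * (gL p - 1) ^ (p - 1) + NL p := by
  obtain ⟨α, h⟩ := he
  have hp : p.Prime := Fact.out
  have hp1 : p - 1 ≠ 0 := by have := hp.two_le; omega
  let ε : L p →ₐ[PadicInt p] PadicInt p :=
    MonoidAlgebra.lift (PadicInt p) (PadicInt p) (Multiplicative (ZMod p)) 1
  have hg : ε (gL p) = 1 := by
    simp [ε, gL]
  have hN : ε (NL p) = p := by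
    simp [NL, map_sum, map_pow, hg]
  have h2 := congrArg ε h
  rw [map_natCast, map_add, map_mul, map_pow, map_sub, hg, map_one, sub_self,
    zero_pow hp1, mul_zero, zero_add, map_smul, hN, smul_eq_mul] at h2
  have hp0 : (p : PadicInt p) ≠ 0 := by exact_mod_cast hp.ne_zero
  have hα : α = 1 := by
    apply mul_right_cancel₀ hp0
    rw [← h2, one_mul]
  rw [hα, one_smul] at h
  exact h

theorem aux_main (p : ℕ) [Fact p.Prime] (e : L p) (he : IsNormLift p e) (j : ℕ) :
    NL p * (p : L p) ^ j
        = (p : L p) ^ (j + 1) - e ^ (j + 1) * (gL p - 1) ^ ((j + 1) * (p - 1)) := by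
  have h := aux_normLift p e he
  have hp : p.Prime := Fact.out
  obtain ⟨m, hm⟩ : ∃ m, p - 1 = m + 1 := ⟨p - 2, by have := hp.two_le; omega⟩
  have hX : NL p * (e * (gL p - 1) ^ (p - 1)) = 0 := by
    rw [hm, pow_succ']
    linear_combination (e * (gL p - 1) ^ m) * aux_NL_mul p
  rw [mul_comm (j + 1), pow_mul, ← mul_pow]
  generalize e * (gL p - 1) ^ (p - 1) = X at *
  generalize (p : L p) = P at *
  induction j with
  | zero => linear_combination -h
  | succ j ih =>
    linear_combination X * ih - P ^ j * hX - P ^ (j + 1) * h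

/-- if `e` is a norm-lift then for every `j ≥ 1` one has
`N·p^j = p^(j+1)·1 − e^(j+1)·(g−1)^((j+1)(p−1))` in `L`; consequently, for every
`ℤ_p[G]`-module `A`, every `a ∈ A` and `b = (g−1)a`, one has
`N·p^j·a = p^(j+1)·a − e^(j+1)·(g−1)^((j+1)(p−1)−1)·b`. -/
theorem stmt_2 (p : ℕ) [Fact p.Prime] (e : L p) (he : IsNormLift p e) :
    (∀ j : ℕ, 1 ≤ j →
      NL p * (p : L p) ^ j
        = (p : L p) ^ (j + 1) - e ^ (j + 1) * (gL p - 1) ^ ((j + 1) * (p - 1))) ∧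
    (∀ (A : Type) [AddCommGroup A] [Module (L p) A], ∀ (a b : A), b = (gL p - 1) • a →
      ∀ j : ℕ, 1 ≤ j →
        (NL p * (p : L p) ^ j) • a
          = (p : L p) ^ (j + 1) • a
            - (e ^ (j + 1) * (gL p - 1) ^ ((j + 1) * (p - 1) - 1)) • b) := by
  refine ⟨fun j _ => aux_main p e he j, ?_⟩
  intro A _ _ a b hb j _
  have hp : p.Prime := Fact.out
  have hpos : (j + 1) * (p - 1) ≠ 0 := by
    have := hp.two_le
    exact Nat.mul_ne_zero (by omega) (by omega)
  rw [hb, smul_smul, mul_assoc, pow_sub_one_mul hpos, aux_main p e he j, sub_smul]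
end
end

section
/- Let e ∈ L be a norm-lift and let M be an L-submodule of L such that the quotient L/M is finite. Then exactly one of the following holds: (1) M = L; (2) M is the submodule generated by g−1 and p^s for some integer s ≥ 1; (3) M is the submodule generated by (g−1)^(r+1) and p^s·1 − e^s·(g−1)^(s(p−1)) − t·(g−1)^r for some integers r ≥ 1, s ≥ 1 and some t ∈ {0,…,p−1}. -/
noncomputable section

/-- The submodule `(g−1)A` of an `ℤ_p[G]`-module `A`. -/
def commSub (p : ℕ) [Fact p.Prime] (A : Type) [AddCommGroup A] [Module (L p) A] :
    Submodule (L p) A :=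
  LinearMap.range (LinearMap.lsmul (L p) A (gL p - 1))

/-- The fixed-point submodule `A^G = {x ∈ A : g·x = x}` of an `ℤ_p[G]`-module `A`. -/
def fixedSub (p : ℕ) [Fact p.Prime] (A : Type) [AddCommGroup A] [Module (L p) A] :
    Submodule (L p) A :=
  LinearMap.ker (LinearMap.lsmul (L p) A (gL p - 1))

/-- An `ℤ_p[G]`-module has rank 1 if it is nonzero and generated by a single element. -/
def IsRankOne (p : ℕ) [Fact p.Prime] (A : Type) [AddCommGroup A] [Module (L p) A] : Prop :=
  Nontrivial A ∧ ∃ a : A, Submodule.span (L p) {a} = ⊤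
/-- Case (1): `M = L`. -/
def CaseOne (p : ℕ) [Fact p.Prime] (M : Submodule (L p) (L p)) : Prop := M = ⊤

/-- Case (2): `M = ⟨g−1, p^s⟩` for some `s ≥ 1`. -/
def CaseTwo (p : ℕ) [Fact p.Prime] (M : Submodule (L p) (L p)) : Prop :=
  ∃ s : ℕ, 1 ≤ s ∧ M = Submodule.span (L p) {gL p - 1, (p : L p) ^ s}

/-- Case (3): `M = ⟨(g−1)^(r+1), p^s·1 − e^s(g−1)^(s(p−1)) − t(g−1)^r⟩` for some
`r, s ≥ 1` and `t ∈ {0,…,p−1}`. -/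
def CaseThree (p : ℕ) [Fact p.Prime] (e : L p) (M : Submodule (L p) (L p)) : Prop :=
  ∃ r s t : ℕ, 1 ≤ r ∧ 1 ≤ s ∧ t < p ∧
    M = Submodule.span (L p)
          {(gL p - 1) ^ (r + 1),
           (p : L p) ^ s - e ^ s * (gL p - 1) ^ (s * (p - 1)) - (t : L p) * (gL p - 1) ^ r}

namespace Aux

variable (p : ℕ) [Fact p.Prime]

abbrev aug : L p →ₐ[PadicInt p] PadicInt p :=
  MonoidAlgebra.lift (PadicInt p) (PadicInt p) (Multiplicative (ZMod p)) 1

abbrev ppi : L p := gL p - 1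

lemma aug_g : aug p (gL p) = 1 := by
  simp [aug, gL]

lemma aug_pi : aug p (ppi p) = 0 := by
  rw [ppi, map_sub, aug_g, map_one, sub_self]

lemma g_pow (k : ℕ) : gL p ^ k =
    MonoidAlgebra.of (PadicInt p) (Multiplicative (ZMod p)) (Multiplicative.ofAdd (k : ZMod p)) := by
  rw [gL, ← map_pow]
  congr 1
  rw [← ofAdd_nsmul]
  simp

lemma g_pow_p : gL p ^ p = 1 := by
  rw [g_pow]
  simp [MonoidAlgebra.one_def]

lemma g_ne : ppi p ≠ 0 := by
  intro h
  have h1 : gL p = 1 := sub_eq_zero.mp h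
  rw [gL, ← map_one (MonoidAlgebra.of (PadicInt p) (Multiplicative (ZMod p)))] at h1
  have := MonoidAlgebra.of_injective h1
  have h2 : (1 : ZMod p) = 0 := this
  exact one_ne_zero h2

lemma decomp (x : L p) : ∃ z, x = algebraMap (PadicInt p) (L p) (aug p x) + ppi p * z := by
  induction x using MonoidAlgebra.induction_on with
  | of a =>
    have h := g_pow p (Multiplicative.toAdd a).val
    rw [ZMod.natCast_zmod_val, ofAdd_toAdd] at h
    rw [← h, map_pow, aug_g, one_pow, map_one]
    obtain ⟨z, hz⟩ := sub_one_dvd_pow_sub_one (gL p) (Multiplicative.toAdd a).val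
    exact ⟨z, by rw [ppi, ← hz]; ring⟩
  | add x y hx hy =>
    obtain ⟨a, ha⟩ := hx
    obtain ⟨b, hb⟩ := hy
    refine ⟨a + b, ?_⟩
    rw [map_add, map_add]
    linear_combination ha + hb
  | smul c x hx =>
    obtain ⟨a, ha⟩ := hx
    refine ⟨algebraMap _ _ c * a, ?_⟩
    rw [map_smul, smul_eq_mul, map_mul, Algebra.smul_def]
    linear_combination (algebraMap (PadicInt p) (L p) c) * ha

lemma pi_pow : ∃ r, ppi p ^ p = (p : L p) * ppi p * r := by
  obtain ⟨r, hr⟩ := exists_add_pow_prime_eq (Fact.out : p.Prime) (ppi p) 1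
  have : ppi p + 1 = gL p := by simp [ppi]
  rw [this, g_pow_p] at hr
  refine ⟨-r, ?_⟩
  linear_combination -hr

lemma isUnit_of (x : L p) (hx : IsUnit (aug p x)) : IsUnit x := by
  by_contra hn
  obtain ⟨m, hm, hxm⟩ := exists_max_ideal_of_mem_nonunits hn
  obtain ⟨z, hz⟩ := decomp p x
  have hfin : Module.Finite (PadicInt p) (L p) :=
    inferInstanceAs (Module.Finite (PadicInt p) (MonoidAlgebra _ _))
  have hint : Algebra.IsIntegral (PadicInt p) (L p) := inferInstance
  have hc := Ideal.isMaximal_comap_of_isIntegral_of_isMaximal (R := PadicInt p) m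
  have hc' := IsLocalRing.eq_maximalIdeal hc
  have hp : (p : PadicInt p) ∈ Ideal.comap (algebraMap (PadicInt p) (L p)) m := by
    rw [hc', PadicInt.maximalIdeal_eq_span_p]
    exact Ideal.subset_span rfl
  rw [Ideal.mem_comap, map_natCast] at hp
  obtain ⟨r, hr⟩ := pi_pow p
  have hpi : ppi p ∈ m := by
    apply hm.isPrime.mem_of_pow_mem p
    rw [hr, mul_assoc]
    exact m.mul_mem_right _ hp
  have : algebraMap (PadicInt p) (L p) (aug p x) ∈ m := by
    have : algebraMap (PadicInt p) (L p) (aug p x) = x - ppi p * z := by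
      linear_combination -hz
    rw [this]
    exact m.sub_mem hxm (m.mul_mem_right _ hpi)
  exact hm.ne_top (Ideal.eq_top_of_isUnit_mem _ this (hx.map _))

variable {p}

lemma p_pi {e : L p} (he : IsNormLift p e) : (p : L p) * ppi p = e * ppi p ^ p := by
  obtain ⟨α, h⟩ := he
  have hN : NL p * ppi p = 0 := by
    rw [NL, ppi, geom_sum_mul, g_pow_p, sub_self]
  have h1 : ppi p ^ p = ppi p ^ (p - 1) * ppi p := by
    rw [← pow_succ, Nat.sub_add_cancel (Fact.out : p.Prime).one_le]
  rw [h1, h, add_mul, smul_mul_assoc, hN, smul_zero]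
  ring

lemma ppow_pi {e : L p} (he : IsNormLift p e) (s : ℕ) :
    ((p : L p) ^ s - e ^ s * ppi p ^ (s * (p - 1))) * ppi p = 0 := by
  have h0 := p_pi he
  have h1 : ppi p ^ p = ppi p ^ (p - 1) * ppi p := by
    rw [← pow_succ, Nat.sub_add_cancel (Fact.out : p.Prime).one_le]
  rw [h1] at h0
  induction s with
  | zero => simp
  | succ s ih =>
    rw [Nat.succ_mul, pow_add]
    linear_combination (p : L p) * ih + e ^ s * ppi p ^ (s * (p - 1)) * h0

/-- `π² y = 0` implies `π y = 0`. -/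
lemma pi_sq {e : L p} (he : IsNormLift p e) (y : L p) (h : ppi p * (ppi p * y) = 0) :
    ppi p * y = 0 := by
  have h0 := p_pi he
  have h2 := (Fact.out : p.Prime).two_le
  have h1 : ppi p ^ p = ppi p ^ (p - 2) * ppi p ^ 2 := by
    rw [← pow_add, Nat.sub_add_cancel h2]
  have h3 : (p : L p) * (ppi p * y) = 0 := by
    rw [h1] at h0
    linear_combination y * h0 + e * ppi p ^ (p - 2) * h
  have h4 : (p : PadicInt p) • (ppi p * y) = 0 := by
    rw [Algebra.smul_def, map_natCast, h3]
  have hp0 : (p : PadicInt p) ≠ 0 := by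
    exact_mod_cast (Fact.out : p.Prime).ne_zero
  ext i
  have h5 := congrArg (fun f : L p => f.coeff i) h4
  have h6 : (p : PadicInt p) * (ppi p * y).coeff i = 0 := h5
  exact (mul_eq_zero.mp h6).resolve_left hp0

/-- elements killed by the augmentation are multiples of `π` -/
lemma dvd_of_aug (x : L p) (h : aug p x = 0) : ∃ z, x = ppi p * z := by
  obtain ⟨z, hz⟩ := decomp p x
  exact ⟨z, by rw [h, map_zero, zero_add] at hz; exact hz⟩

/-- absorb `p` multiples -/
lemma p_absorb {e : L p} (he : IsNormLift p e) (j : ℕ) (hj : 1 ≤ j) :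
    ∃ w, (p : L p) * ppi p ^ j = ppi p ^ (j + 1) * w := by
  have h0 := p_pi he
  have h2 := (Fact.out : p.Prime).two_le
  have h1 : ppi p ^ p = ppi p ^ (p - 2) * ppi p ^ 2 := by
    rw [← pow_add, Nat.sub_add_cancel h2]
  obtain ⟨i, rfl⟩ := Nat.exists_eq_add_of_le' hj
  rw [h1] at h0
  refine ⟨e * ppi p ^ (p - 2), ?_⟩
  linear_combination ppi p ^ i * h0

lemma dvd_p (c : PadicInt p) (h : ¬ IsUnit c) : ∃ d, c = p * d := by
  have : c ∈ IsLocalRing.maximalIdeal (PadicInt p) := h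
  rw [PadicInt.maximalIdeal_eq_span_p, Ideal.mem_span_singleton] at this
  exact this

lemma inter {e : L p} (he : IsNormLift p e) (M : Submodule (L p) (L p)) (k : ℕ)
    (hmin : ∀ j, 1 ≤ j → j < k → ppi p ^ j ∉ M) (x : L p) (hx : x ∈ M) (hx0 : aug p x = 0) :
    ∀ j, 1 ≤ j → j ≤ k → ∃ y, x = ppi p ^ j * y := by
  intro j hj
  induction j, hj using Nat.le_induction with
  | base => intro _; simpa using dvd_of_aug x hx0
  | succ j hj ih =>
    intro hk
    obtain ⟨y, hy⟩ := ih (by omega)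
    by_cases hu : IsUnit (aug p y)
    · exfalso
      obtain ⟨u, hu⟩ := isUnit_of p y hu
      apply hmin j hj (by omega)
      have : ppi p ^ j = (↑u⁻¹ : L p) • x := by
        rw [hy, ← hu, smul_eq_mul, mul_comm, mul_assoc, Units.mul_inv, mul_one]
      rw [this]
      exact M.smul_mem _ hx
    · obtain ⟨d, hd⟩ := dvd_p _ hu
      obtain ⟨z, hz⟩ := decomp p y
      obtain ⟨w, hw⟩ := p_absorb he j hj
      rw [hd, map_mul, map_natCast] at hz
      refine ⟨w * algebraMap _ _ d + z, ?_⟩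
      rw [hy]
      linear_combination ppi p ^ j * hz + algebraMap (PadicInt p) (L p) d * hw

lemma exists_p_pow (M : Submodule (L p) (L p)) (hfin : Finite (L p ⧸ M)) :
    ∃ a : ℕ, (p : L p) ^ a ∈ M := by
  have hn0 : Nat.card (L p ⧸ M) ≠ 0 := Nat.card_pos.ne'
  set n := Nat.card (L p ⧸ M) with hn
  have h1 : ((n : ℕ) : L p) ∈ M := by
    rw [← Submodule.Quotient.mk_eq_zero]
    have : ((n : ℕ) : L p) = n • (1 : L p) := by simp
    rw [this, Submodule.Quotient.mk_smul]
    exact card_nsmul_eq_zero'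
  have hz : (n : PadicInt p) ≠ 0 := by exact_mod_cast hn0
  have hs := PadicInt.unitCoeff_spec hz
  refine ⟨(n : PadicInt p).valuation, ?_⟩
  set u := PadicInt.unitCoeff hz
  have h2 := congrArg (algebraMap (PadicInt p) (L p)) hs
  rw [map_mul, map_pow, map_natCast, map_natCast] at h2
  have h3 : algebraMap (PadicInt p) (L p) (↑u⁻¹) * algebraMap (PadicInt p) (L p) u = 1 := by
    rw [← map_mul, Units.inv_mul, map_one]
  have h4 : (p : L p) ^ (n : PadicInt p).valuation
      = algebraMap (PadicInt p) (L p) (↑u⁻¹) • (n : L p) := by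
    rw [smul_eq_mul]
    linear_combination -algebraMap (PadicInt p) (L p) (↑u⁻¹) * h2
      - (p : L p) ^ (n : PadicInt p).valuation * h3
  rw [h4]
  exact M.smul_mem _ h1

lemma exists_pi_pow (M : Submodule (L p) (L p)) (a : ℕ) (h : (p : L p) ^ a ∈ M) :
    ∃ k, 1 ≤ k ∧ ppi p ^ k ∈ M := by
  obtain ⟨r, hr⟩ := pi_pow p
  refine ⟨p * (a + 1), Nat.mul_pos (Fact.out : p.Prime).pos (by omega), ?_⟩
  have : ppi p ^ (p * (a + 1)) = ((p : L p) * ppi p ^ (a + 1) * r ^ (a + 1)) • (p : L p) ^ a := by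
    rw [pow_mul, hr, smul_eq_mul, mul_pow, mul_pow, pow_succ (p : L p)]; ring
  rw [this]
  exact M.smul_mem _ h

lemma exists_aug (M : Submodule (L p) (L p)) (a : ℕ) (h : (p : L p) ^ a ∈ M) :
    ∃ s, (∃ x ∈ M, aug p x = (p : PadicInt p) ^ s) ∧
      ∀ x ∈ M, ∃ c, aug p x = c * (p : PadicInt p) ^ s := by
  classical
  have hex : ∃ s, ∃ x ∈ M, aug p x = (p : PadicInt p) ^ s :=
    ⟨a, _, h, by rw [map_pow, map_natCast]⟩
  refine ⟨Nat.find hex, Nat.find_spec hex, ?_⟩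
  intro x hx
  by_cases h0 : aug p x = 0
  · exact ⟨0, by rw [h0, zero_mul]⟩
  have hs := PadicInt.unitCoeff_spec h0
  set u := PadicInt.unitCoeff h0
  have hle : Nat.find hex ≤ (aug p x).valuation := by
    apply Nat.find_min'
    refine ⟨algebraMap (PadicInt p) (L p) (↑u⁻¹) • x, M.smul_mem _ hx, ?_⟩
    rw [smul_eq_mul, map_mul, AlgHom.commutes]
    have h3 : (↑u⁻¹ : PadicInt p) * (u : PadicInt p) = 1 := Units.inv_mul u
    change (↑u⁻¹ : PadicInt p) * _ = _
    linear_combination (↑u⁻¹ : PadicInt p) * hs + (p : PadicInt p) ^ (aug p x).valuation * h3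
  refine ⟨u * (p : PadicInt p) ^ ((aug p x).valuation - Nat.find hex), ?_⟩
  rw [mul_assoc, ← pow_add, Nat.sub_add_cancel hle]
  exact hs

lemma not_unit_pow (s : ℕ) (hs : 1 ≤ s) (c : PadicInt p) : c * (p : PadicInt p) ^ s ≠ 1 := by
  intro h
  have h1 : IsUnit ((p : PadicInt p) ^ s) := IsUnit.of_mul_eq_one_right c h
  have h2 := (isUnit_pow_iff (by omega)).mp h1
  exact PadicInt.p_nonunit h2

lemma aug_gen3 (e : L p) (r s t : ℕ) (hr : 1 ≤ r) (hs : 1 ≤ s) :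
    aug p ((p : L p) ^ s - e ^ s * ppi p ^ (s * (p - 1)) - (t : L p) * ppi p ^ r)
      = (p : PadicInt p) ^ s := by
  have h2 := (Fact.out : p.Prime).two_le
  have : s * (p - 1) ≠ 0 := Nat.mul_ne_zero (by omega) (by omega)
  rw [map_sub, map_sub, map_mul, map_mul, map_pow (aug p) (ppi p), map_pow (aug p) (ppi p),
    aug_pi, zero_pow this, zero_pow (by omega), map_pow, map_natCast]
  simp

lemma not12 (M : Submodule (L p) (L p)) (h2 : CaseTwo p M) : ¬ CaseOne p M := by
  intro h1
  obtain ⟨s, hs, hM⟩ := h2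
  have : (1 : L p) ∈ M := by rw [h1]; trivial
  rw [hM, Submodule.mem_span_pair] at this
  obtain ⟨a, b, hab⟩ := this
  have := congrArg (aug p) hab
  rw [smul_eq_mul, smul_eq_mul, map_add, map_mul, map_mul, aug_pi, map_pow, map_natCast, map_one,
    mul_zero, zero_add] at this
  exact not_unit_pow s hs _ this

lemma not13 (e : L p) (M : Submodule (L p) (L p)) (h3 : CaseThree p e M) : ¬ CaseOne p M := by
  intro h1
  obtain ⟨r, s, t, hr, hs, ht, hM⟩ := h3
  have : (1 : L p) ∈ M := by rw [h1]; trivial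
  rw [hM, Submodule.mem_span_pair] at this
  obtain ⟨a, b, hab⟩ := this
  have := congrArg (aug p) hab
  rw [smul_eq_mul, smul_eq_mul, map_add, map_mul, map_mul, aug_gen3 e r s t hr hs, map_pow, aug_pi,
    map_one, zero_pow (by omega), mul_zero, zero_add] at this
  exact not_unit_pow s hs _ this

lemma not23 {e : L p} (he : IsNormLift p e) (M : Submodule (L p) (L p))
    (h3 : CaseThree p e M) : ¬ CaseTwo p M := by
  rintro ⟨s', hs', hM'⟩
  obtain ⟨r, s, t, hr, hs, ht, hM⟩ := h3
  have : ppi p ∈ M := by rw [hM']; exact Submodule.subset_span (by simp)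
  rw [hM, Submodule.mem_span_pair] at this
  obtain ⟨a, b, hab⟩ := this
  rw [smul_eq_mul, smul_eq_mul] at hab
  have h := congrArg (aug p) hab
  rw [map_add, map_mul, map_mul, aug_gen3 e r s t hr hs, map_pow, aug_pi,
    zero_pow (by omega), mul_zero, zero_add] at h
  have hp0 : (p : PadicInt p) ≠ 0 := by
    exact_mod_cast (Fact.out : p.Prime).ne_zero
  have hb := (mul_eq_zero.mp h).resolve_right (pow_ne_zero _ hp0)
  obtain ⟨z, rfl⟩ := dvd_of_aug b hb
  have hk := ppow_pi he s
  obtain ⟨i, rfl⟩ := Nat.exists_eq_add_of_le' hr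
  have h5 : ppi p * (1 - ppi p * (a * ppi p ^ i - z * t * ppi p ^ i)) = 0 := by
    change a * ppi p ^ (i + 1 + 1) + ppi p * z * ((p : L p) ^ s - e ^ s * ppi p ^ (s * (p - 1)) -
      (t : L p) * ppi p ^ (i + 1)) = ppi p at hab
    linear_combination z * hk - hab
  have hu := isUnit_of p (1 - ppi p * (a * ppi p ^ i - z * t * ppi p ^ i)) (by
    rw [map_sub, map_mul, aug_pi, map_one, zero_mul, sub_zero]; exact isUnit_one)
  exact g_ne p (hu.mul_left_eq_zero.mp h5)

lemma exhaust {e : L p} (he : IsNormLift p e) (M : Submodule (L p) (L p))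
    (hfin : Finite (L p ⧸ M)) : CaseOne p M ∨ CaseTwo p M ∨ CaseThree p e M := by
  classical
  obtain ⟨a, ha⟩ := exists_p_pow M hfin
  obtain ⟨s, ⟨x, hxM, hx⟩, hs⟩ := exists_aug M a ha
  have hk := exists_pi_pow M a ha
  obtain ⟨k, hk1, hkM, hmin⟩ : ∃ k, 1 ≤ k ∧ ppi p ^ k ∈ M ∧ 
      ∀ j, 1 ≤ j → j < k → ppi p ^ j ∉ M :=
    ⟨Nat.find hk, (Nat.find_spec hk).1, (Nat.find_spec hk).2,
      fun j hj hjk hm => Nat.find_min hk hjk ⟨hj, hm⟩⟩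
  obtain rfl | hs1 := Nat.eq_zero_or_pos s
  · left
    have hu := isUnit_of p x (by rw [hx, pow_zero]; exact isUnit_one)
    exact Ideal.eq_top_of_isUnit_mem M hxM hu
  right
  -- general generation principle
  have gen : ∀ y ∈ M, aug p y = (p : PadicInt p) ^ s →
      M = Submodule.span (L p) {ppi p ^ k, y} := by
    intro y hy hya
    apply le_antisymm
    · intro m hm
      obtain ⟨c, hc⟩ := hs m hm
      have hm' : m - algebraMap (PadicInt p) (L p) c • y ∈ M := M.sub_mem hm (M.smul_mem _ hy)
      have h0 : aug p (m - algebraMap (PadicInt p) (L p) c • y) = 0 := by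
        rw [smul_eq_mul, map_sub, map_mul, AlgHom.commutes, hya, hc]
        exact sub_self _
      obtain ⟨w, hw⟩ := inter he M k hmin _ hm' h0 k hk1 le_rfl
      rw [Submodule.mem_span_pair]
      refine ⟨w, algebraMap (PadicInt p) (L p) c, ?_⟩
      rw [smul_eq_mul w, mul_comm w, ← hw]
      abel
    · rw [Submodule.span_le]
      rintro z (rfl | rfl)
      · exact hkM
      · exact hy
  obtain ⟨r, rfl⟩ := Nat.exists_eq_add_of_le' hk1
  obtain rfl | hr := Nat.eq_zero_or_pos r
  · left
    refine ⟨s, hs1, ?_⟩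
    rw [zero_add, pow_one] at gen hkM
    apply gen
    · obtain ⟨z, hz⟩ := decomp p x
      rw [hx, map_pow, map_natCast] at hz
      have : (p : L p) ^ s = x - z • ppi p := by
        rw [smul_eq_mul]; linear_combination -hz
      rw [this]
      exact M.sub_mem hxM (M.smul_mem _ hkM)
    · rw [map_pow, map_natCast]
  · right
    -- z = p^s - e^s π^.. - x
    set q : L p := (p : L p) ^ s - e ^ s * ppi p ^ (s * (p - 1)) with hq
    have hqpi : q * ppi p = 0 := ppow_pi he s
    have hqa : aug p q = (p : PadicInt p) ^ s := by
      have := aug_gen3 e r s 0 hr hs1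
      simpa [hq] using this
    obtain ⟨z, hz⟩ := dvd_of_aug (q - x) (by rw [map_sub, hqa, hx, sub_self])
    have h1 : ppi p • x ∈ M := M.smul_mem _ hxM
    obtain ⟨w, hw⟩ := inter he M (r + 1) hmin _ h1
      (by rw [smul_eq_mul, map_mul, aug_pi, zero_mul]) (r + 1) hk1 le_rfl
    rw [smul_eq_mul] at hw
    obtain ⟨i, rfl⟩ := Nat.exists_eq_add_of_le' hr
    have h2 : ppi p * (z + ppi p ^ i * w) = 0 := by
      apply pi_sq he
      linear_combination hqpi - ppi p * hz - hw
    -- x = q + π^r w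
    have hxq : x = q + ppi p ^ (i + 1) * w := by
      linear_combination -h2 - hz
    obtain ⟨t, ht, d, hd⟩ : ∃ t : ℕ, t < p ∧ ∃ d, -aug p w = t + p * d := by
      refine ⟨PadicInt.zmodRepr (-aug p w), PadicInt.zmodRepr_lt_p _, ?_⟩
      have := PadicInt.sub_zmodRepr_mem (-aug p w)
      obtain ⟨d, hd⟩ := dvd_p _ this
      exact ⟨d, by linear_combination hd⟩
    refine ⟨i + 1, s, t, hr, hs1, ht, ?_⟩
    apply gen
    · obtain ⟨v, hv⟩ := decomp p w
      obtain ⟨c, hc⟩ := p_absorb he (i + 1) hr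
      have hd' := congrArg (algebraMap (PadicInt p) (L p)) hd
      rw [map_neg, map_add, map_mul, map_natCast, map_natCast] at hd'
      have : (p : L p) ^ s - e ^ s * ppi p ^ (s * (p - 1)) - (t : L p) * ppi p ^ (i + 1)
          = x + (algebraMap (PadicInt p) (L p) d * c - v) • ppi p ^ (i + 1 + 1) := by
        rw [smul_eq_mul, ← hq]
        linear_combination -hxq - ppi p ^ (i + 1) * hv + ppi p ^ (i + 1) * hd'
          + algebraMap (PadicInt p) (L p) d * hc
      rw [this]
      exact M.add_mem hxM (M.smul_mem _ hkM)
    · exact aug_gen3 e (i + 1) s t hr hs1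

end Aux

/-- for a norm-lift `e` and a submodule `M ⊆ L` with `L/M` finite,
exactly one of the three cases above holds. -/
theorem stmt_5 (p : ℕ) [Fact p.Prime] (e : L p) (he : IsNormLift p e)
    (M : Submodule (L p) (L p)) (hfin : Finite (L p ⧸ M)) :
    (CaseOne p M ∧ ¬CaseTwo p M ∧ ¬CaseThree p e M) ∨
    (¬CaseOne p M ∧ CaseTwo p M ∧ ¬CaseThree p e M) ∨
    (¬CaseOne p M ∧ ¬CaseTwo p M ∧ CaseThree p e M) := by
  have h := Aux.exhaust he M hfin
  have h12 := Aux.not12 M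
  have h13 := Aux.not13 e M
  have h23 := Aux.not23 he M
  tauto
end
end

section
/- Let M and M′ be L-submodules of L such that L/M is finite. If L/M and L/M′ are isomorphic as L-modules, then M = M′. (Every finite quotient of ℤ_p[G] arises from a unique submodule.) -/
noncomputable section

/-- if `L/M` is finite and `L/M ≅ L/M′` as `L`-modules, then `M = M′`:
every finite quotient of `ℤ_p[G]` arises from a unique submodule. -/
theorem stmt_6 (p : ℕ) [Fact p.Prime]
    (M M' : Submodule (L p) (L p)) (hfin : Finite (L p ⧸ M))
    (hiso : Nonempty ((L p ⧸ M) ≃ₗ[L p] (L p ⧸ M'))) :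
    M = M' := by
  obtain ⟨e⟩ := hiso
  have h := e.annihilator_eq
  have h1 : Module.annihilator (L p) (L p ⧸ M) = M := Ideal.annihilator_quotient (I := M)
  have h2 : Module.annihilator (L p) (L p ⧸ M') = M' := Ideal.annihilator_quotient (I := M')
  exact h1.symm.trans (h.trans h2)
end
end

section
/- Let e ∈ L be a norm-lift, let r ≥ 1, s ≥ 1 be integers and t ∈ {0,…,p−1}, and let M be the L-submodule of L generated by (g−1)^(r+1) and p^s·1 − e^s·(g−1)^(s(p−1)) − t·(g−1)^r. Then the quotient A = L/M is finite of cardinality p^(r+s); moreover |(g−1)A| = p^r and |A^G| = p^s. -/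
noncomputable section

section aux

variable {p : ℕ} [Fact p.Prime] {R : Type} [CommRing R] (x N : R) (ε : R →+* PadicInt p)

theorem aux_range (hx : ε x = 0) (hker : ∀ a, ε a = 0 → x ∣ a)
    (hann : ∀ a, x * a = 0 → N ∣ a) (hxN : x * N = 0)
    (r m : ℕ) (y : R) (hy : ε y = (p : PadicInt p) ^ m) (hxy : x ^ (r + 1) ∣ x * y)
    (I : Submodule R R) (hI : I = Submodule.span R {x ^ (r + 1), y}) :
    Nat.card (LinearMap.range (LinearMap.lsmul R (R ⧸ I) x)) =
      Nat.card (R ⧸ (Submodule.span R {x ^ r, N} : Submodule R R)) := by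
  have hp : (p : PadicInt p) ^ m ≠ 0 := by
    apply pow_ne_zero
    exact_mod_cast (Fact.out : p.Prime).ne_zero
  let f : R →ₗ[R] (R ⧸ I) := (LinearMap.lsmul R (R ⧸ I) x) ∘ₗ I.mkQ
  have hfr : LinearMap.range f = LinearMap.range (LinearMap.lsmul R (R ⧸ I) x) := by
    rw [LinearMap.range_comp_of_range_eq_top]
    exact Submodule.range_mkQ I
  have hfk : LinearMap.ker f = Submodule.span R {x ^ r, N} := by
    ext a
    have h1 : a ∈ LinearMap.ker f ↔ x * a ∈ I := by
      rw [LinearMap.mem_ker]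
      change x • I.mkQ a = 0 ↔ _
      rw [← map_smul, Submodule.mkQ_apply, Submodule.Quotient.mk_eq_zero, smul_eq_mul]
    rw [h1, hI, Submodule.mem_span_pair, Submodule.mem_span_pair]
    constructor
    · rintro ⟨b, c, h⟩
      simp only [smul_eq_mul] at h
      have h2 : ε c * (p : PadicInt p) ^ m = 0 := by
        have := congrArg ε h
        simpa [hx, hy] using this
      have h3 : ε c = 0 := by
        rcases mul_eq_zero.1 h2 with h | h
        · exact h
        · exact absurd h hp
      obtain ⟨d, rfl⟩ := hker c h3
      obtain ⟨k, hk⟩ := hxy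
      obtain ⟨n, hn⟩ := hann (a - x ^ r * (b + d * k)) (by linear_combination (-1) * h + d * hk)
      exact ⟨b + d * k, n, by simp only [smul_eq_mul]; linear_combination (-1) * hn⟩
    · rintro ⟨b, c, h⟩
      simp only [smul_eq_mul] at h
      exact ⟨b, 0, by simp only [smul_eq_mul]; linear_combination x * h - c * hxN⟩
  rw [← hfr, ← hfk]
  exact (Nat.card_congr f.quotKerEquivRange.toEquiv).symm

theorem aux_card (hεs : Function.Surjective ε) (hx : ε x = 0) (hker : ∀ a, ε a = 0 → x ∣ a)
    (r m : ℕ) (y : R) (hy : ε y = (p : PadicInt p) ^ m)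
    (I : Submodule R R) (hI : I = Submodule.span R {x ^ (r + 1), y}) :
    Nat.card (R ⧸ I) =
      Nat.card (LinearMap.range (LinearMap.lsmul R (R ⧸ I) x)) * p ^ m := by
  have : NeZero (p ^ m) := ⟨pow_ne_zero _ (Fact.out : p.Prime).ne_zero⟩
  let φ : R →+* ZMod (p ^ m) := (PadicInt.toZModPow m).comp ε
  have hφ : Function.Surjective φ := ZMod.ringHom_surjective φ
  have hφ0 : ∀ a, φ a = 0 ↔ (p : PadicInt p) ^ m ∣ ε a := by
    intro a
    rw [← Ideal.mem_span_singleton, ← PadicInt.ker_toZModPow, RingHom.mem_ker]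
    rfl
  have hle : I.toAddSubgroup ≤ φ.toAddMonoidHom.ker := by
    intro a ha
    have ha : a ∈ I := ha
    rw [hI, Submodule.mem_span_pair] at ha
    obtain ⟨b, c, h⟩ := ha
    change φ a = 0
    rw [hφ0, ← h]
    simp [hx, hy]
  let ψ : (R ⧸ I) →+ ZMod (p ^ m) := QuotientAddGroup.lift I.toAddSubgroup φ.toAddMonoidHom hle
  have hψm : ∀ a, ψ (I.mkQ a) = φ a := fun a => rfl
  have hψ : Function.Surjective ψ := fun z => by
    obtain ⟨a, rfl⟩ := hφ z
    exact ⟨I.mkQ a, rfl⟩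
  have hk : ψ.ker = (LinearMap.range (LinearMap.lsmul R (R ⧸ I) x)).toAddSubgroup := by
    ext q
    obtain ⟨a, rfl⟩ := I.mkQ_surjective q
    rw [AddMonoidHom.mem_ker, hψm, hφ0, Submodule.mem_toAddSubgroup, LinearMap.mem_range]
    constructor
    · rintro ⟨c, hc⟩
      obtain ⟨d, hd⟩ : ∃ d, ε d = c := hεs c
      obtain ⟨b, hb⟩ := hker (a - y * d) (by rw [map_sub, map_mul, hy, hd, hc, sub_self])
      refine ⟨I.mkQ b, ?_⟩
      change x • I.mkQ b = _
      rw [← map_smul, ← sub_eq_zero, ← map_sub, Submodule.mkQ_apply,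
        Submodule.Quotient.mk_eq_zero, hI, Submodule.mem_span_pair]
      exact ⟨0, -d, by simp only [smul_eq_mul]; linear_combination hb⟩
    · rintro ⟨q, hq⟩
      obtain ⟨b, rfl⟩ := I.mkQ_surjective q
      rw [← hφ0, ← hψm, ← hq]
      change ψ (x • I.mkQ b) = 0
      rw [← map_smul, hψm, hφ0]
      simp [hx]
  have h1 := ψ.ker.card_mul_index
  rw [AddSubgroup.index_ker, AddMonoidHom.range_eq_top.2 hψ, hk] at h1
  rw [← h1]
  have h2 : Nat.card (⊤ : AddSubgroup (ZMod (p ^ m))) = p ^ m := by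
    rw [AddSubgroup.card_top, Nat.card_zmod]
  rw [h2]
  rfl

end aux

/-- for a norm-lift `e`, integers `r, s ≥ 1` and `t ∈ {0,…,p−1}`, the quotient
`A = L/⟨(g−1)^(r+1), p^s·1 − e^s(g−1)^(s(p−1)) − t(g−1)^r⟩` is finite of cardinality
`p^(r+s)`, with `|(g−1)A| = p^r` and `|A^G| = p^s`. -/
theorem stmt_7 (p : ℕ) [Fact p.Prime] (e : L p) (he : IsNormLift p e)
    (r s t : ℕ) (hr : 1 ≤ r) (hs : 1 ≤ s) (htp : t < p)
    (M : Submodule (L p) (L p))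
    (hM : M = Submodule.span (L p)
        {(gL p - 1) ^ (r + 1),
         (p : L p) ^ s - e ^ s * (gL p - 1) ^ (s * (p - 1)) - (t : L p) * (gL p - 1) ^ r}) :
    Finite (L p ⧸ M) ∧
    Nat.card (L p ⧸ M) = p ^ (r + s) ∧
    Nat.card (commSub p (L p ⧸ M)) = p ^ r ∧
    Nat.card (fixedSub p (L p ⧸ M)) = p ^ s := by
  have hpp : p.Prime := Fact.out
  obtain ⟨ε, hεs, hεg, hker⟩ : ∃ ε : L p →+* PadicInt p, Function.Surjective ε ∧ ε (gL p) = 1 ∧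
      ∀ a, ε a = 0 → gL p - 1 ∣ a := by
    let E : L p →ₐ[PadicInt p] PadicInt p := MonoidAlgebra.lift _ _ _ 1
    have hEof : ∀ h, E (MonoidAlgebra.of (PadicInt p) (Multiplicative (ZMod p)) h) = 1 := by
      intro h; simp [E]
    refine ⟨E.toRingHom, fun c => ⟨algebraMap _ _ c, E.commutes c⟩, hEof _, ?_⟩
    have key : ∀ a, gL p - 1 ∣ a - algebraMap (PadicInt p) (L p) (E a) := by
      intro a
      induction a using MonoidAlgebra.induction_on with
      | of h =>
        rw [hEof, map_one]
        have : MonoidAlgebra.of (PadicInt p) (Multiplicative (ZMod p)) h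
            = gL p ^ (Multiplicative.toAdd h).val := by
          rw [gL, ← map_pow, ← ofAdd_nsmul]
          congr 1
          simp
        rw [this]
        exact sub_one_dvd_pow_sub_one _ _
      | add a b ha hb =>
        have := dvd_add ha hb
        rw [map_add, map_add]
        convert this using 1
        ring
      | smul c a ha =>
        have := ha.mul_left (algebraMap (PadicInt p) (L p) c)
        rw [map_smul, smul_eq_mul, map_mul, Algebra.smul_def, ← mul_sub]
        exact this
    intro a ha
    have ha : E a = 0 := ha
    have := key a
    rwa [ha, map_zero, sub_zero] at this
  have hgp : gL p ^ p = 1 := by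
    rw [gL, ← map_pow, ← ofAdd_nsmul]
    simp [MonoidAlgebra.one_def]
  have hxN : (gL p - 1) * NL p = 0 := by
    rw [NL, mul_geom_sum, hgp, sub_self]
  have hann : ∀ a, (gL p - 1) * a = 0 → NL p ∣ a := by
    intro a ha
    have h1 : ∀ h : Multiplicative (ZMod p), a.coeff (Multiplicative.ofAdd 1 * h) = a.coeff h := by
      intro h
      have h2 : gL p * a = a := by linear_combination ha
      have h3 : (gL p * a).coeff (Multiplicative.ofAdd 1 * h) = a.coeff h := by
        simp [gL]
      rw [← h3, h2]
    have h2 : ∀ n : ℕ, a.coeff (Multiplicative.ofAdd (n : ZMod p)) = a.coeff 1 := by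
      intro n
      induction n with
      | zero => simp
      | succ n ih =>
        rw [← ih, ← h1 (Multiplicative.ofAdd (n : ZMod p)), ← ofAdd_add]
        push_cast
        rw [add_comm]
    have h3 : ∀ h, a.coeff h = a.coeff 1 := by
      intro h
      have := h2 (Multiplicative.toAdd h).val
      simpa using this
    have h4 : ∀ h, (NL p).coeff h = 1 := by
      intro h
      have hgi : ∀ i : ℕ, (gL p ^ i).coeff h =
          if Multiplicative.ofAdd (i : ZMod p) = h then 1 else 0 := by
        intro i
        rw [gL, ← map_pow, ← ofAdd_nsmul, nsmul_one, MonoidAlgebra.of_apply,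
          MonoidAlgebra.coeff_single_apply]
      rw [NL, MonoidAlgebra.coeff_sum, Finsupp.finset_sum_apply,
        Finset.sum_eq_single (Multiplicative.toAdd h).val, hgi]
      · simp
      · intro i hi hne
        rw [hgi, if_neg]
        rintro rfl
        apply hne
        rw [toAdd_ofAdd, ZMod.val_natCast, Nat.mod_eq_of_lt (Finset.mem_range.1 hi)]
      · intro hn
        exact absurd (Finset.mem_range.2 (ZMod.val_lt _)) hn
    refine ⟨algebraMap (PadicInt p) (L p) (a.coeff 1), ?_⟩
    rw [mul_comm, ← Algebra.smul_def]
    ext h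
    rw [MonoidAlgebra.coeff_smul_apply, h4, h3 h]
    simp
  have hx : ε (gL p - 1) = 0 := by rw [map_sub, hεg, map_one, sub_self]
  have hN : ε (NL p) = (p : PadicInt p) ^ 1 := by simp [NL, hεg]
  have hbase : ∀ k, Nat.card (L p ⧸ (Submodule.span (L p) {(gL p - 1) ^ k, NL p} :
      Submodule (L p) (L p))) = p ^ k := by
    intro k
    induction k with
    | zero =>
      have : (Submodule.span (L p) {(gL p - 1) ^ 0, NL p} : Submodule (L p) (L p)) = ⊤ := by
        rw [pow_zero]
        exact Ideal.eq_top_of_isUnit_mem _ (Submodule.subset_span (by simp)) isUnit_one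
      rw [this, pow_zero]
      exact Nat.card_unique
    | succ k ih =>
      rw [aux_card (gL p - 1) ε hεs hx hker k 1 (NL p) hN _ rfl,
        aux_range (gL p - 1) (NL p) ε hx hker hann hxN k 1 (NL p) hN (by simp [hxN]) _ rfl, ih]
      ring
  set y := (p : L p) ^ s - e ^ s * (gL p - 1) ^ (s * (p - 1)) - (t : L p) * (gL p - 1) ^ r with hyd
  have hy : ε y = (p : PadicInt p) ^ s := by
    have h1 : s * (p - 1) ≠ 0 := by
      have := hpp.two_le
      exact mul_ne_zero (by omega) (by omega)
    have h2 : r ≠ 0 := by omega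
    simp only [hyd, map_sub, map_mul ε, map_pow ε, hx, zero_pow h1, zero_pow h2]
    simp
  have hxy : (gL p - 1) ^ (r + 1) ∣ (gL p - 1) * y := by
    obtain ⟨α, hα⟩ := he
    have h1 : (p : L p) - e * (gL p - 1) ^ (p - 1) ∣
      (p : L p) ^ s - (e * (gL p - 1) ^ (p - 1)) ^ s := sub_dvd_pow_sub_pow _ _ _
    obtain ⟨c, hc⟩ := h1
    have h2 : (p : L p) - e * (gL p - 1) ^ (p - 1) = α • NL p := by
      rw [sub_eq_iff_eq_add']; exact hα
    rw [h2, mul_pow, ← pow_mul, mul_comm (p - 1) s, Algebra.smul_def] at hc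
    refine ⟨-(t : L p), ?_⟩
    rw [hyd, hc]
    linear_combination (algebraMap (PadicInt p) (L p) α * c) * hxN
  have hR := aux_range (gL p - 1) (NL p) ε hx hker hann hxN r s y hy hxy M hM
  rw [hbase] at hR
  have hC := aux_card (gL p - 1) ε hεs hx hker r s y hy M hM
  rw [hR, ← pow_add] at hC
  refine ⟨Nat.finite_of_card_ne_zero (by rw [hC]; exact pow_ne_zero _ hpp.ne_zero), hC, hR, ?_⟩
  have h1 := (LinearMap.lsmul (L p) (L p ⧸ M) (gL p - 1)).toAddMonoidHom.ker.card_mul_index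
  rw [AddSubgroup.index_ker, hC] at h1
  have h3 : Nat.card (fixedSub p (L p ⧸ M)) * p ^ r = p ^ (r + s) := by
    rw [← hR]; exact h1
  rw [add_comm, pow_add] at h3
  exact Nat.eq_of_mul_eq_mul_right (pow_pos hpp.pos r) h3
end
end

section
/- For every integer n ≥ 2, the number of L-submodules M ⊆ L with |L/M| = p^n equals 1 + p(n−1); for n = 0 and n = 1 this number equals 1. -/
noncomputable section

set_option linter.unusedSectionVars false

/-- abstract node data -/
structure NodeData (p : ℕ) (R : Type) [CommRing R] where
  x : R
  y : R
  φ : R →+* ZMod p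
  hxy : x * y = 0
  hφ : ∀ r, φ r = 0 ↔ ∃ α β, r = x * α + y * β
  h1 : ∀ z w, x * z = y * w → ∃ v, z = y * v
  h2 : ∀ z w, y * z = x * w → ∃ v, z = x * v
  hnil : ∀ (I : Submodule R R) (n : ℕ), Nat.card (R ⧸ I) = p ^ n → ∃ A, x ^ A ∈ I ∧ y ^ A ∈ I

namespace NodeData

variable {p : ℕ} {R : Type} [CommRing R] (D : NodeData p R)

/-- swapping the two branches -/
def swap : NodeData p R where
  x := D.y
  y := D.x
  φ := D.φ
  hxy := by rw [mul_comm]; exact D.hxy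
  hφ := fun r => (D.hφ r).trans ⟨fun ⟨a, b, h⟩ => ⟨b, a, by rw [h]; ring⟩,
    fun ⟨a, b, h⟩ => ⟨b, a, by rw [h]; ring⟩⟩
  h1 := D.h2
  h2 := D.h1
  hnil := fun I n h => (D.hnil I n h).imp fun _ h => h.symm

lemma φx : D.φ D.x = 0 := (D.hφ _).2 ⟨1, 0, by ring⟩
lemma φy : D.φ D.y = 0 := (D.hφ _).2 ⟨0, 1, by ring⟩

/-- F1 -/
lemma F1 (a : ℕ) (r s t : R) (h : r * D.x ^ a = s * D.x ^ (a + 1) + t * D.y) : D.φ r = 0 := by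
  induction a generalizing t with
  | zero =>
    refine (D.hφ r).2 ⟨s, t, ?_⟩
    linear_combination h
  | succ a ih =>
    obtain ⟨v, hv⟩ := D.h1 (r * D.x ^ a - s * D.x ^ (a + 1)) t (by linear_combination h)
    exact ih v (by linear_combination hv)

lemma F2 (a : ℕ) (r s t : R) (h : r * D.y ^ a = s * D.y ^ (a + 1) + t * D.x) : D.φ r = 0 :=
  D.swap.F1 a r s t h

lemma card_ker (K : Submodule R R) (hK : ∀ r, r ∈ K ↔ D.φ r = 0) : Nat.card (R ⧸ K) = p := by
  have e := QuotientAddGroup.quotientKerEquivOfSurjective D.φ.toAddMonoidHom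
    (ZMod.ringHom_surjective D.φ)
  have hk : D.φ.toAddMonoidHom.ker = K.toAddSubgroup := by
    ext r
    rw [AddMonoidHom.mem_ker, Submodule.mem_toAddSubgroup, hK]
    rfl
  have h1 : Nat.card (R ⧸ D.φ.toAddMonoidHom.ker) = p := by
    rw [Nat.card_congr e.toEquiv, Nat.card_zmod]
  rw [hk] at h1
  exact h1

lemma e_nil {I : Submodule R R} {A : ℕ} (hx : D.x ^ A ∈ I) (hy : D.y ^ A ∈ I)
    (e : R) (he : D.φ e = 0) : ∃ k, e ^ k ∈ I := by
  obtain ⟨α, β, rfl⟩ := (D.hφ e).1 he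
  have h : D.x * α + D.y * β ∈ Ideal.radical I :=
    Ideal.add_mem _ (Ideal.mul_mem_right _ _ ⟨A, hx⟩) (Ideal.mul_mem_right _ _ ⟨A, hy⟩)
  exact h

variable [hp : Fact p.Prime]

lemma inv_exists (r : R) (hr : D.φ r ≠ 0) : ∃ s, D.φ (s * r) = 1 := by
  obtain ⟨s, hs⟩ := ZMod.ringHom_surjective D.φ (D.φ r)⁻¹
  exact ⟨s, by rw [map_mul, hs, inv_mul_cancel₀ hr]⟩

lemma U {I : Submodule R R} {A : ℕ} (hx : D.x ^ A ∈ I) (hy : D.y ^ A ∈ I)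
    (r z : R) (hr : D.φ r ≠ 0) (h : r * z ∈ I) : z ∈ I := by
  obtain ⟨s, hs⟩ := D.inv_exists r hr
  obtain ⟨k, hk⟩ := D.e_nil hx hy (1 - s * r) (by rw [map_sub, hs, map_one, sub_self])
  obtain ⟨q, hq⟩ := sub_dvd_pow_sub_pow (1 : R) (1 - s * r) k
  have : z = (q * s) • (r * z) + z • (1 - s * r) ^ k := by
    simp only [smul_eq_mul]
    linear_combination z * hq - z * (one_pow k : (1:R) ^ k = 1)
  rw [this]
  exact I.add_mem (I.smul_mem _ h) (I.smul_mem _ hk)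

/-- step lemma -/
lemma step (I K : Submodule R R) (z : R) (hK : K = I ⊔ Submodule.span R {z})
    (hxz : D.x * z ∈ I) (hyz : D.y * z ∈ I) (hz : z ∉ I) :
    Nat.card (R ⧸ I) = p * Nat.card (R ⧸ K) := by
  have hIK : I ≤ K := hK ▸ le_sup_left
  rw [← Submodule.card_quotient_mul_card_quotient K I hIK]
  congr 1
  have hm : Submodule.map I.mkQ K = (LinearMap.toSpanSingleton R (R ⧸ I) (I.mkQ z)).range := by
    rw [← LinearMap.span_singleton_eq_range, hK, Submodule.map_sup, Submodule.map_span,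
      Set.image_singleton]
    have : Submodule.map I.mkQ I = ⊥ := by
      rw [eq_bot_iff, Submodule.map_le_iff_le_comap, Submodule.comap_bot, Submodule.ker_mkQ]
    rw [this, bot_sup_eq]
  rw [hm, ← Nat.card_congr (LinearMap.quotKerEquivRange _).toEquiv]
  apply D.card_ker
  intro r
  have key : r ∈ (LinearMap.toSpanSingleton R (R ⧸ I) (I.mkQ z)).ker ↔ r * z ∈ I := by
    rw [LinearMap.mem_ker, LinearMap.toSpanSingleton_apply, ← map_smul, Submodule.mkQ_apply,
      Submodule.Quotient.mk_eq_zero, smul_eq_mul]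
  rw [key]
  have hm : ∀ e, D.φ e = 0 → e * z ∈ I := by
    intro e he
    obtain ⟨α, β, rfl⟩ := (D.hφ e).1 he
    have : (D.x * α + D.y * β) * z = α • (D.x * z) + β • (D.y * z) := by
      simp only [smul_eq_mul]; ring
    rw [this]
    exact I.add_mem (I.smul_mem _ hxz) (I.smul_mem _ hyz)
  refine ⟨fun h => ?_, hm r⟩
  by_contra hr
  obtain ⟨s, hs⟩ := D.inv_exists r hr
  apply hz
  have := I.add_mem (I.smul_mem s h) (hm (1 - s * r) (by rw [map_sub, hs, map_one, sub_self]))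
  convert this using 1
  simp only [smul_eq_mul]; ring


/-- `(x^a, y^b)` -/
def P (a b : ℕ) : Submodule R R := Ideal.span {D.x ^ a, D.y ^ b}

lemma mem_P {a b : ℕ} {z : R} : z ∈ D.P a b ↔ ∃ s t, s * D.x ^ a + t * D.y ^ b = z :=
  Ideal.mem_span_pair

/-- lift of a residue -/
def li (_ : NodeData p R) (c : ZMod p) : R := ((c.val : ℕ) : R)

lemma φli (c : ZMod p) : D.φ (D.li c) = c := by
  simp [li]

/-- `(x^(a+1), y^(b+1), x^a + c y^b)` -/
def J (a b : ℕ) (c : ZMod p) : Submodule R R :=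
  D.P (a + 1) (b + 1) ⊔ Submodule.span R {D.x ^ a + D.li c * D.y ^ b}

lemma mem_J {a b : ℕ} {c : ZMod p} {z : R} : z ∈ D.J a b c ↔
    ∃ s t w, s * D.x ^ (a + 1) + t * D.y ^ (b + 1) + w * (D.x ^ a + D.li c * D.y ^ b) = z := by
  unfold J
  rw [Submodule.mem_sup]
  constructor
  · rintro ⟨u, hu, v, hv, rfl⟩
    obtain ⟨s, t, rfl⟩ := D.mem_P.1 hu
    obtain ⟨w, rfl⟩ := Submodule.mem_span_singleton.1 hv
    exact ⟨s, t, w, rfl⟩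
  · rintro ⟨s, t, w, rfl⟩
    exact ⟨_, D.mem_P.2 ⟨s, t, rfl⟩, _, Submodule.mem_span_singleton.2 ⟨w, rfl⟩, rfl⟩

lemma x_mem_P {a b k : ℕ} (hb : 1 ≤ b) (hp : 1 < p) : D.x ^ k ∈ D.P a b ↔ a ≤ k := by
  have : Fact (1 < p) := ⟨hp⟩
  constructor
  · intro h
    by_contra hk
    push Not at hk
    obtain ⟨s, t, h⟩ := D.mem_P.1 h
    obtain ⟨b, rfl⟩ := Nat.exists_eq_add_of_le hb
    obtain ⟨d, rfl⟩ := Nat.exists_eq_add_of_lt hk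
    have := D.F1 k 1 (s * D.x ^ d) (t * D.y ^ b) (by rw [← sub_eq_zero] at h ⊢; rw [← neg_eq_zero, ← h]; ring)
    simp at this
  · intro h
    obtain ⟨d, rfl⟩ := Nat.exists_eq_add_of_le h
    exact D.mem_P.2 ⟨D.x ^ d, 0, by ring⟩

lemma P_swap (a b : ℕ) : D.swap.P a b = D.P b a := by
  unfold P
  rw [Set.pair_comm]; rfl

lemma y_mem_P {a b k : ℕ} (ha : 1 ≤ a) (hp : 1 < p) : D.y ^ k ∈ D.P a b ↔ b ≤ k := by
  rw [← D.P_swap b a]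
  exact D.swap.x_mem_P ha hp

/-- T -/
lemma T {a b : ℕ} (ha : 1 ≤ a) (hb : 1 ≤ b) {c : ZMod p} {α β : R}
    (h : α * D.x ^ a + β * D.y ^ b ∈ D.J a b c) : D.φ β = D.φ α * c := by
  obtain ⟨s, t, w, h⟩ := D.mem_J.1 h
  obtain ⟨a, rfl⟩ := Nat.exists_eq_add_of_le ha
  obtain ⟨b, rfl⟩ := Nat.exists_eq_add_of_le hb
  have e1 := D.F1 (1 + a) (α - w) s (t * D.y ^ (1 + b) + w * D.li c * D.y ^ b - β * D.y ^ b)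
    (by linear_combination (-1 : R) * h)
  have e2 := D.F2 (1 + b) (β - w * D.li c) t (s * D.x ^ (1 + a) + w * D.x ^ a - α * D.x ^ a)
    (by linear_combination (-1 : R) * h)
  rw [map_sub, sub_eq_zero] at e1 e2
  rw [e1, e2, map_mul, φli]

lemma P_le_J (a b : ℕ) (c : ZMod p) : D.P (a + 1) (b + 1) ≤ D.J a b c := le_sup_left

lemma J_le_P (a b : ℕ) (c : ZMod p) : D.J a b c ≤ D.P a b := by
  intro z hz
  obtain ⟨s, t, w, rfl⟩ := D.mem_J.1 hz
  exact D.mem_P.2 ⟨s * D.x + w, t * D.y + w * D.li c, by ring⟩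


lemma x_mem_J {a b k : ℕ} (ha : 1 ≤ a) (hb : 1 ≤ b) {c : ZMod p} (hc : c ≠ 0) :
    D.x ^ k ∈ D.J a b c ↔ a + 1 ≤ k := by
  constructor
  · intro h
    have h1 := (D.x_mem_P hb hp.out.one_lt).1 (D.J_le_P _ _ _ h)
    rcases h1.eq_or_lt with rfl | h1
    · have := D.T ha hb (c := c) (α := 1) (β := 0) (by simpa using h)
      simp at this
      exact absurd this.symm hc
    · exact h1
  · intro h
    exact D.P_le_J _ _ _ ((D.x_mem_P (by omega) hp.out.one_lt).2 h)

lemma y_mem_J {a b k : ℕ} (ha : 1 ≤ a) (hb : 1 ≤ b) {c : ZMod p} :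
    D.y ^ k ∈ D.J a b c ↔ b + 1 ≤ k := by
  constructor
  · intro h
    have h1 := (D.y_mem_P ha hp.out.one_lt).1 (D.J_le_P _ _ _ h)
    rcases h1.eq_or_lt with rfl | h1
    · have := D.T ha hb (c := c) (α := 0) (β := 1) (by simpa using h)
      simp at this
    · exact h1
  · intro h
    exact D.P_le_J _ _ _ ((D.y_mem_P (by omega) hp.out.one_lt).2 h)

lemma xy_pow {b : ℕ} (hb : 1 ≤ b) : D.x * D.y ^ b = 0 := by
  obtain ⟨b, rfl⟩ := Nat.exists_eq_add_of_le hb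
  rw [pow_add, pow_one, ← mul_assoc, D.hxy, zero_mul]

lemma yx_pow {a : ℕ} (ha : 1 ≤ a) : D.y * D.x ^ a = 0 := D.swap.xy_pow ha

lemma card_P_succ {a b : ℕ} (ha : 1 ≤ a) (hb : 1 ≤ b) :
    Nat.card (R ⧸ D.P (a + 1) b) = p * Nat.card (R ⧸ D.P a b) := by
  apply D.step _ _ (D.x ^ a)
  · apply le_antisymm
    · intro z hz
      obtain ⟨s, t, rfl⟩ := D.mem_P.1 hz
      rw [add_comm (s * _)]
      exact Submodule.add_mem_sup (D.mem_P.2 ⟨0, t, by ring⟩)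
        (Submodule.mem_span_singleton.2 ⟨s, rfl⟩)
    · rw [sup_le_iff, Submodule.span_singleton_le_iff_mem]
      refine ⟨?_, D.mem_P.2 ⟨1, 0, by ring⟩⟩
      intro z hz
      obtain ⟨s, t, rfl⟩ := D.mem_P.1 hz
      exact D.mem_P.2 ⟨s * D.x, t, by ring⟩
  · exact D.mem_P.2 ⟨1, 0, by ring⟩
  · rw [D.yx_pow ha]; exact Submodule.zero_mem _
  · rw [D.x_mem_P hb hp.out.one_lt]; omega

lemma card_P (a b : ℕ) : Nat.card (R ⧸ D.P (a + 1) (b + 1)) = p ^ (a + b + 1) := by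
  induction a with
  | succ a ih => rw [D.card_P_succ (by omega) (by omega), ih]; ring
  | zero =>
    induction b with
    | succ b ih =>
      rw [← P_swap, D.swap.card_P_succ (by omega) (by omega), P_swap, ih]; ring
    | zero =>
      rw [D.card_ker]
      · simp
      · intro r
        rw [D.hφ, mem_P]
        constructor
        · rintro ⟨s, t, rfl⟩; exact ⟨s, t, by ring⟩
        · rintro ⟨s, t, rfl⟩; exact ⟨s, t, by ring⟩

lemma card_J {a b : ℕ} (c : ZMod p) (hc : c ≠ 0) :
    Nat.card (R ⧸ D.J (a + 1) (b + 1) c) = p ^ (a + b + 2) := by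
  have : Nat.card (R ⧸ D.J (a + 1) (b + 1) c) = p * Nat.card (R ⧸ D.P (a + 1) (b + 1)) := by
    apply D.step _ _ (D.x ^ (a + 1))
    · apply le_antisymm
      · obtain ⟨s, hs⟩ := D.inv_exists (D.li c) (by rwa [φli])
        obtain ⟨u, v, huv⟩ := (D.hφ (1 - s * D.li c)).1 (by rw [map_sub, hs, map_one, sub_self])
        have hx : D.x ^ (a + 1) ∈ D.J (a + 1) (b + 1) c ⊔ Submodule.span R {D.x ^ (a + 1)} :=
          Submodule.mem_sup_right (Submodule.mem_span_singleton_self _)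
        have hy : D.y ^ (b + 1) ∈ D.J (a + 1) (b + 1) c ⊔ Submodule.span R {D.x ^ (a + 1)} := by
          have : D.y ^ (b + 1) = (v * D.y ^ (b + 2) + s * (D.x ^ (a + 1) + D.li c * D.y ^ (b + 1)))
              + (- s) * D.x ^ (a + 1) := by
            linear_combination D.y ^ (b + 1) * huv + u * D.y ^ b * D.hxy
          rw [this]
          exact Submodule.add_mem_sup (D.mem_J.2 ⟨0, v, s, by ring⟩)
            (Submodule.mem_span_singleton.2 ⟨-s, rfl⟩)
        intro z hz
        obtain ⟨s, t, rfl⟩ := D.mem_P.1 hz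
        exact Submodule.add_mem _ (Submodule.smul_mem _ _ hx) (Submodule.smul_mem _ _ hy)
      · rw [sup_le_iff, Submodule.span_singleton_le_iff_mem]
        exact ⟨D.J_le_P _ _ _, D.mem_P.2 ⟨1, 0, by ring⟩⟩
    · exact D.mem_J.2 ⟨1, 0, 0, by ring⟩
    · rw [D.yx_pow (by omega)]; exact Submodule.zero_mem _
    · rw [D.x_mem_J (by omega) (by omega) hc]; omega
  rw [this, card_P]; ring

/-- pushing up the x-part -/
lemma push {I : Submodule R R} {A : ℕ} (hx : D.x ^ A ∈ I) (hy : D.y ^ A ∈ I) (a : ℕ)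
    (ha : ∀ k, k < a → D.x ^ k ∉ I) (i : ℕ) (α : R) (h : D.x ^ i * (D.x * α) ∈ I) (j : ℕ)
    (hj : 1 ≤ j) (hja : i + j ≤ a) : ∃ γ, D.x * α = D.x ^ j * γ := by
  induction j, hj using Nat.le_induction with
  | base => exact ⟨α, by ring⟩
  | succ j hj ih =>
    obtain ⟨γ, hγ⟩ := ih (by omega)
    have h0 : D.φ γ = 0 := by
      by_contra h0
      apply ha (i + j) (by omega)
      apply D.U hx hy γ _ h0
      rw [hγ] at h
      convert h using 1; ring
    obtain ⟨u, v, huv⟩ := (D.hφ _).1 h0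
    refine ⟨u, ?_⟩
    rw [hγ, huv]
    obtain ⟨j, rfl⟩ := Nat.exists_eq_add_of_le hj
    linear_combination D.x ^ j * v * D.hxy

lemma classify (I : Submodule R R) (n : ℕ) (hI : Nat.card (R ⧸ I) = p ^ n) (hn : I ≠ ⊤) :
    (∃ a b, I = D.P (a + 1) (b + 1)) ∨ (∃ a b c, c ≠ 0 ∧ I = D.J (a + 1) (b + 1) c) := by
  obtain ⟨A, hxA, hyA⟩ := D.hnil I n hI
  classical
  have h1 : (1 : R) ∉ I := fun h => hn ((Ideal.eq_top_iff_one I).2 h)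
  have hIm : ∀ r ∈ I, D.φ r = 0 := by
    intro r hr
    by_contra h0
    exact h1 (D.U hxA hyA r 1 h0 (by simpa using hr))
  have ex : ∃ k, D.x ^ k ∈ I := ⟨A, hxA⟩
  have ey : ∃ k, D.y ^ k ∈ I := ⟨A, hyA⟩
  obtain ⟨a, hxa, hax⟩ : ∃ a, D.x ^ (a + 1) ∈ I ∧ ∀ k, k < a + 1 → D.x ^ k ∉ I := by
    have h := Nat.find_spec ex
    have hm : ∀ k, k < Nat.find ex → D.x ^ k ∉ I := fun k hk => Nat.find_min ex hk
    rcases hf : Nat.find ex with _ | a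
    · rw [hf] at h; simp at h; exact absurd h h1
    · rw [hf] at h hm; exact ⟨a, h, hm⟩
  obtain ⟨b, hyb, hby⟩ : ∃ b, D.y ^ (b + 1) ∈ I ∧ ∀ k, k < b + 1 → D.y ^ k ∉ I := by
    have h := Nat.find_spec ey
    have hm : ∀ k, k < Nat.find ey → D.y ^ k ∉ I := fun k hk => Nat.find_min ey hk
    rcases hf : Nat.find ey with _ | a
    · rw [hf] at h; simp at h; exact absurd h h1
    · rw [hf] at h hm; exact ⟨a, h, hm⟩
  have hPI : D.P (a + 1) (b + 1) ≤ I := by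
    intro z hz
    obtain ⟨s, t, rfl⟩ := D.mem_P.1 hz
    exact Submodule.add_mem _ (Submodule.smul_mem _ _ hxa) (Submodule.smul_mem _ _ hyb)
  -- if one of the parts lies in `I`
  have both : ∀ α β, D.x * α ∈ I → D.y * β ∈ I → D.x * α + D.y * β ∈ D.P (a + 1) (b + 1) := by
    intro α β hα hβ
    obtain ⟨γ, hγ⟩ := D.push hxA hyA (a + 1) hax 0 α (by simpa using hα) (a + 1) (by omega) (by omega)
    obtain ⟨δ, hδ⟩ := D.swap.push hyA hxA (b + 1) hby 0 β
      (by rw [pow_zero, one_mul]; exact hβ) (b + 1) (by omega) (by omega)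
    change D.y * β = D.y ^ (b + 1) * δ at hδ
    exact D.mem_P.2 ⟨γ, δ, by rw [hγ, hδ]; ring⟩
  by_cases ha : a = 0
  · left
    refine ⟨a, b, le_antisymm ?_ hPI⟩
    intro z hz
    obtain ⟨α, β, rfl⟩ := (D.hφ z).1 (hIm z hz)
    have hα : D.x * α ∈ I := by
      subst ha
      have := I.smul_mem α hxa
      simpa [mul_comm] using this
    exact both α β hα ((Submodule.add_mem_iff_right _ hα).1 hz)
  by_cases hb : b = 0
  · left
    refine ⟨a, b, le_antisymm ?_ hPI⟩
    intro z hz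
    obtain ⟨α, β, rfl⟩ := (D.hφ z).1 (hIm z hz)
    have hβ : D.y * β ∈ I := by
      subst hb
      have := I.smul_mem β hyb
      simpa [mul_comm] using this
    exact both α β ((Submodule.add_mem_iff_left _ hβ).1 hz) hβ
  obtain ⟨a, rfl⟩ := Nat.exists_eq_succ_of_ne_zero ha
  obtain ⟨b, rfl⟩ := Nat.exists_eq_succ_of_ne_zero hb
  simp only [Nat.succ_eq_add_one] at *
  have form : ∀ z ∈ I, ∃ α β, z = α * D.x ^ (a + 1) + β * D.y ^ (b + 1) := by
    intro z hz
    obtain ⟨α, β, rfl⟩ := (D.hφ z).1 (hIm z hz)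
    obtain ⟨γ, hγ⟩ := D.push hxA hyA (a + 1 + 1) hax 1 α (by
      have := I.smul_mem D.x hz
      convert this using 1
      simp only [smul_eq_mul]
      linear_combination (- β) * D.hxy) (a + 1) (by omega) (by omega)
    obtain ⟨δ, hδ⟩ := D.swap.push hyA hxA (b + 1 + 1) hby 1 β (by
      have := I.smul_mem D.y hz
      convert this using 1
      change D.y ^ 1 * (D.y * β) = _
      simp only [smul_eq_mul]
      linear_combination (- α) * D.hxy) (b + 1) (by omega) (by omega)
    change D.y * β = D.y ^ (b + 1) * δ at hδ
    exact ⟨γ, δ, by rw [hγ, hδ]; ring⟩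
  have upx : ∀ α, D.φ α = 0 → ∃ s, α * D.x ^ (a + 1) = s * D.x ^ (a + 1 + 1) := by
    intro α h
    obtain ⟨u, v, rfl⟩ := (D.hφ α).1 h
    exact ⟨u, by linear_combination v * D.x ^ a * D.hxy⟩
  have upy : ∀ α, D.φ α = 0 → ∃ s, α * D.y ^ (b + 1) = s * D.y ^ (b + 1 + 1) := by
    intro α h
    obtain ⟨u, v, rfl⟩ := (D.hφ α).1 h
    exact ⟨v, by linear_combination u * D.y ^ b * D.hxy⟩
  have hyφ : ∀ β, β * D.y ^ (b + 1) ∈ I → D.φ β = 0 := by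
    intro β h
    by_contra h0
    exact hby (b + 1) (by omega) (D.U hxA hyA β _ h0 h)
  have hxφ : ∀ β, β * D.x ^ (a + 1) ∈ I → D.φ β = 0 := by
    intro β h
    by_contra h0
    exact hax (a + 1) (by omega) (D.U hxA hyA β _ h0 h)
  by_cases hall : ∃ α β, α * D.x ^ (a + 1) + β * D.y ^ (b + 1) ∈ I ∧ D.φ α ≠ 0
  · right
    obtain ⟨α, β, hr, hα⟩ := hall
    obtain ⟨s, hs⟩ := D.inv_exists α hα
    set c := D.φ (s * β) with hc
    have hmem : D.x ^ (a + 1) + D.li c * D.y ^ (b + 1) ∈ I := by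
      obtain ⟨u, hu⟩ := upx (1 - s * α) (by rw [map_sub, hs, map_one, sub_self])
      obtain ⟨v, hv⟩ := upy (D.li c - s * β) (by rw [map_sub, φli, hc, sub_self])
      have : D.x ^ (a + 1) + D.li c * D.y ^ (b + 1) =
          s • (α * D.x ^ (a + 1) + β * D.y ^ (b + 1)) + (u • D.x ^ (a + 1 + 1)
            + v • D.y ^ (b + 1 + 1)) := by
        simp only [smul_eq_mul]
        linear_combination hu + hv
      rw [this]
      exact I.add_mem (I.smul_mem _ hr) (I.add_mem (I.smul_mem _ hxa) (I.smul_mem _ hyb))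
    refine ⟨a, b, c, ?_, le_antisymm ?_ ?_⟩
    · intro hc0
      rw [hc0] at hmem
      have : D.x ^ (a + 1) ∈ I := by simpa [li] using hmem
      exact hax _ (by omega) this
    · intro z hz
      obtain ⟨γ, δ, rfl⟩ := form z hz
      have hd : (δ - γ * D.li c) * D.y ^ (b + 1) ∈ I := by
        have := I.sub_mem hz (I.smul_mem γ hmem)
        convert this using 1
        simp only [smul_eq_mul]; ring
      obtain ⟨v, hv⟩ := upy _ (hyφ _ hd)
      exact D.mem_J.2 ⟨0, v, γ, by linear_combination - hv⟩
    · refine sup_le hPI ?_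
      rw [Submodule.span_singleton_le_iff_mem]; exact hmem
  · left
    push Not at hall
    refine ⟨a + 1, b + 1, le_antisymm ?_ hPI⟩
    intro z hz
    obtain ⟨α, β, rfl⟩ := form z hz
    obtain ⟨u, hu⟩ := upx α (hall α β hz)
    rw [hu] at hz
    obtain ⟨v, hv⟩ := upy β (hyφ β ((Submodule.add_mem_iff_right _ (I.smul_mem u hxa)).1 hz))
    exact D.mem_P.2 ⟨u, v, by rw [hu, hv]⟩

lemma count (D : NodeData p R) (n : ℕ) :
    Nat.card {M : Submodule R R // Nat.card (R ⧸ M) = p ^ (n + 1)} = 1 + p * n := by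
  let f : Fin (n + 1) ⊕ (Fin n × (ZMod p)ˣ) →
      {M : Submodule R R // Nat.card (R ⧸ M) = p ^ (n + 1)} := fun q => match q with
    | .inl i => ⟨D.P (i + 1) (n - i + 1), by rw [card_P]; congr 1; omega⟩
    | .inr (i, c) => ⟨D.J (i + 1) (n - 1 - i + 1) c, by
        rw [D.card_J _ c.ne_zero]; congr 1; omega⟩
  have hp1 := hp.out.one_lt
  have hf : Function.Bijective f := by
    constructor
    · rintro (i | ⟨i, c⟩) (j | ⟨j, d⟩) h
      · have h' : D.P (i + 1) (n - i + 1) = D.P (j + 1) (n - j + 1) := congrArg Subtype.val h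
        have e : ∀ k, (i : ℕ) + 1 ≤ k ↔ (j : ℕ) + 1 ≤ k := fun k => by
          rw [← D.x_mem_P (b := n - i + 1) (by omega) hp1, h', D.x_mem_P (by omega) hp1]
        have e1 := (e (i + 1)).1 le_rfl
        have e2 := (e (j + 1)).2 le_rfl
        congr 1; ext; omega
      · exfalso
        have h' : D.P (i + 1) (n - i + 1) = D.J (j + 1) (n - 1 - j + 1) d := congrArg Subtype.val h
        have e : ∀ k, (i : ℕ) + 1 ≤ k ↔ (j : ℕ) + 1 + 1 ≤ k := fun k => by
          rw [← D.x_mem_P (b := n - i + 1) (by omega) hp1, h',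
            D.x_mem_J (by omega) (by omega) d.ne_zero]
        have e' : ∀ k, (n - i : ℕ) + 1 ≤ k ↔ (n - 1 - j : ℕ) + 1 + 1 ≤ k := fun k => by
          rw [← D.y_mem_P (a := i + 1) (by omega) hp1, h', D.y_mem_J (by omega) (by omega)]
        have e1 := (e (i + 1)).1 le_rfl
        have e2 := (e (j + 1 + 1)).2 le_rfl
        have e3 := (e' (n - i + 1)).1 le_rfl
        have e4 := (e' (n - 1 - j + 1 + 1)).2 le_rfl
        omega
      · exfalso
        have h' : D.P (j + 1) (n - j + 1) = D.J (i + 1) (n - 1 - i + 1) c :=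
          (congrArg Subtype.val h).symm
        have e : ∀ k, (j : ℕ) + 1 ≤ k ↔ (i : ℕ) + 1 + 1 ≤ k := fun k => by
          rw [← D.x_mem_P (b := n - j + 1) (by omega) hp1, h',
            D.x_mem_J (by omega) (by omega) c.ne_zero]
        have e' : ∀ k, (n - j : ℕ) + 1 ≤ k ↔ (n - 1 - i : ℕ) + 1 + 1 ≤ k := fun k => by
          rw [← D.y_mem_P (a := j + 1) (by omega) hp1, h', D.y_mem_J (by omega) (by omega)]
        have e1 := (e (j + 1)).1 le_rfl
        have e2 := (e (i + 1 + 1)).2 le_rfl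
        have e3 := (e' (n - j + 1)).1 le_rfl
        have e4 := (e' (n - 1 - i + 1 + 1)).2 le_rfl
        omega
      · have h' : D.J (i + 1) (n - 1 - i + 1) c = D.J (j + 1) (n - 1 - j + 1) d :=
          congrArg Subtype.val h
        have e : ∀ k, (i : ℕ) + 1 + 1 ≤ k ↔ (j : ℕ) + 1 + 1 ≤ k := fun k => by
          rw [← D.x_mem_J (b := n - 1 - i + 1) (by omega) (by omega) c.ne_zero, h',
            D.x_mem_J (by omega) (by omega) d.ne_zero]
        have e1 := (e (i + 1 + 1)).1 le_rfl
        have e2 := (e (j + 1 + 1)).2 le_rfl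
        have hij : i = j := by ext; omega
        subst hij
        have hm : 1 * D.x ^ ((i : ℕ) + 1) + D.li c * D.y ^ (n - 1 - i + 1) ∈
            D.J (i + 1) (n - 1 - i + 1) d := by
          rw [← h']
          exact D.mem_J.2 ⟨0, 0, 1, by ring⟩
        have := D.T (by omega) (by omega) hm
        rw [φli, map_one, one_mul] at this
        rw [Units.ext this]
    · rintro ⟨M, hM⟩
      have hne : M ≠ ⊤ := by
        rintro rfl
        have : Nat.card (R ⧸ (⊤ : Submodule R R)) = 1 := by simp
        rw [this] at hM
        exact absurd hM.symm (Nat.one_lt_pow (by omega) hp1).ne'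
      rcases D.classify M _ hM hne with ⟨a, b, rfl⟩ | ⟨a, b, c, hc, rfl⟩
      · have := hM
        rw [card_P] at this
        have := Nat.pow_right_injective hp1 this
        refine ⟨.inl ⟨a, by omega⟩, Subtype.ext ?_⟩
        change D.P (a + 1) (n - a + 1) = D.P (a + 1) (b + 1)
        congr 2; omega
      · have := hM
        rw [D.card_J c hc] at this
        have := Nat.pow_right_injective hp1 this
        refine ⟨.inr (⟨a, by omega⟩, Units.mk0 c hc), Subtype.ext ?_⟩
        change D.J (a + 1) (n - 1 - a + 1) c = D.J (a + 1) (b + 1) c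
        congr 2; omega
  rw [← Nat.card_congr (Equiv.ofBijective f hf), Nat.card_sum, Nat.card_prod, Nat.card_fin,
    Nat.card_fin, Nat.card_eq_fintype_card (α := (ZMod p)ˣ), ZMod.card_units]
  obtain ⟨q, rfl⟩ := Nat.exists_eq_add_of_le hp.out.one_le
  simp; ring

end NodeData

section Concrete
variable (p : ℕ) [hp : Fact p.Prime]

/-- augmentation -/
def aug : L p →ₐ[PadicInt p] PadicInt p := MonoidAlgebra.lift _ _ _ 1

lemma ofL_pow (m : Multiplicative (ZMod p)) :
    MonoidAlgebra.of (PadicInt p) (Multiplicative (ZMod p)) m = gL p ^ (m.toAdd.val) := by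
  rw [gL, ← map_pow]
  congr 1
  rw [← ofAdd_nsmul]
  simp

lemma aug_of (m : Multiplicative (ZMod p)) :
    aug p (MonoidAlgebra.of (PadicInt p) (Multiplicative (ZMod p)) m) = 1 := by
  unfold aug
  rw [MonoidAlgebra.lift_of]; rfl

lemma aug_g : aug p (gL p) = 1 := aug_of p _

lemma g_pow : gL p ^ p = 1 := by
  rw [gL, ← map_pow, ← ofAdd_nsmul]
  simp [MonoidAlgebra.one_def]

lemma aug_dvd (r : L p) : gL p - 1 ∣ r - algebraMap (PadicInt p) (L p) (aug p r) := by
  induction r using MonoidAlgebra.induction_on with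
  | of m =>
    rw [aug_of, map_one, ofL_pow]
    simpa using sub_dvd_pow_sub_pow (gL p) 1 m.toAdd.val
  | add a b ha hb =>
    have := dvd_add ha hb
    rw [map_add, map_add]
    convert this using 1; ring
  | smul c a ha =>
    have := Dvd.dvd.mul_left ha (algebraMap (PadicInt p) (L p) c)
    rw [map_smul, smul_eq_mul, map_mul, Algebra.smul_def]
    convert this using 1; ring

lemma dvd_of_aug {r : L p} (h : aug p r = 0) : ∃ v, r = (gL p - 1) * v := by
  have := aug_dvd p r
  rwa [h, map_zero, sub_zero] at this

lemma aug_N : aug p (NL p) = p := by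
  simp [NL, aug_g]

lemma xN : (gL p - 1) * NL p = 0 := by
  rw [NL, mul_geom_sum, g_pow, sub_self]

lemma N_mul (z : L p) : NL p * z = NL p * algebraMap (PadicInt p) (L p) (aug p z) := by
  obtain ⟨v, hv⟩ := aug_dvd p z
  linear_combination NL p * hv + v * xN p

lemma inv_coeff {z : L p} (hz : (gL p - 1) * z = 0) (m : Multiplicative (ZMod p)) :
    z.coeff m = z.coeff 1 := by
  have h1 : gL p * z = z := by linear_combination hz
  have h2 : ∀ k : ℕ, gL p ^ k * z = z := by
    intro k
    induction k with
    | zero => simp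
    | succ k ih => rw [pow_succ, mul_assoc, h1, ih]
  have h3 := h2 m.toAdd.val
  rw [← ofL_pow, MonoidAlgebra.of_apply] at h3
  conv_lhs => rw [← h3]
  rw [MonoidAlgebra.coeff_single_mul_apply]
  simp

lemma N_coeff : (NL p).coeff 1 = 1 := by
  have : ∀ i ∈ Finset.range p, (gL p ^ i).coeff 1 = if i = 0 then 1 else 0 := by
    intro i hi
    rw [gL, ← map_pow, ← ofAdd_nsmul, MonoidAlgebra.of_apply, MonoidAlgebra.coeff_single,
      Finsupp.single_apply]
    congr 1
    rw [nsmul_one, ofAdd_eq_one, ZMod.natCast_eq_zero_iff]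
    rw [Finset.mem_range] at hi
    exact propext ⟨fun h => Nat.eq_zero_of_dvd_of_lt h hi, fun h => h ▸ dvd_zero _⟩
  rw [NL, MonoidAlgebra.coeff_sum, Finsupp.finsetSum_apply, Finset.sum_congr rfl this]
  simp [hp.out.ne_zero]

lemma ker_x {z : L p} (hz : (gL p - 1) * z = 0) : ∃ v, z = NL p * v := by
  refine ⟨algebraMap _ _ (z.coeff 1), ?_⟩
  rw [mul_comm, ← Algebra.smul_def]
  ext m
  have hN := inv_coeff p (xN p) m
  rw [inv_coeff p hz m, MonoidAlgebra.coeff_smul, Finsupp.smul_apply, hN, N_coeff, smul_eq_mul, mul_one]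

lemma aug_x : aug p (gL p - 1) = 0 := by rw [map_sub, aug_g, map_one, sub_self]

lemma p_ne : (p : PadicInt p) ≠ 0 := by exact_mod_cast hp.out.ne_zero

/-- the node structure on `L p` -/
def nodeL : NodeData p (L p) where
  x := gL p - 1
  y := NL p
  φ := (PadicInt.toZMod (p := p)).comp (aug p).toRingHom
  hxy := xN p
  hφ := by
    intro r
    change PadicInt.toZMod (aug p r) = 0 ↔ _
    constructor
    · intro h
      have h1 : aug p r ∈ RingHom.ker (PadicInt.toZMod (p := p)) := h
      rw [PadicInt.ker_toZMod, PadicInt.maximalIdeal_eq_span_p, Ideal.mem_span_singleton] at h1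
      obtain ⟨s, hs⟩ := h1
      obtain ⟨v, hv⟩ := dvd_of_aug p (r := r - NL p * algebraMap _ _ s) (by
        rw [map_sub, map_mul, aug_N, hs, AlgHom.commutes]; simp)
      exact ⟨v, algebraMap _ _ s, by linear_combination hv⟩
    · rintro ⟨a, b, rfl⟩
      rw [map_add, map_mul, map_mul, aug_x, aug_N]
      simp
  h1 := by
    intro z w h
    apply ker_x
    have := congrArg (aug p) h
    rw [map_mul, map_mul, aug_x, aug_N, zero_mul] at this
    have hw : aug p w = 0 := (mul_eq_zero.1 this.symm).resolve_left (p_ne p)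
    rw [h, N_mul, hw, map_zero, mul_zero]
  h2 := by
    intro z w h
    apply dvd_of_aug
    have := congrArg (aug p) h
    rw [map_mul, map_mul, aug_x, aug_N, zero_mul] at this
    exact (mul_eq_zero.1 this).resolve_left (p_ne p)
  hnil := by
    intro I n h
    have hpn : ((p : L p)) ^ n ∈ I := by
      have h1 : Nat.card (L p ⧸ I) • (I.mkQ 1) = 0 := card_nsmul_eq_zero'
      rw [h, ← map_nsmul, Submodule.mkQ_apply, Submodule.Quotient.mk_eq_zero] at h1
      simpa using h1
    have hmul : ∀ z, (p : L p) ^ n ∣ z → z ∈ I := by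
      rintro _ ⟨v, rfl⟩
      rw [mul_comm]
      exact I.smul_mem v hpn
    have hx : (p : L p) ∣ (gL p - 1) ^ p := by
      obtain ⟨r, hr⟩ := exists_add_pow_prime_eq hp.out (gL p - 1) 1
      rw [sub_add_cancel, g_pow, one_pow] at hr
      exact ⟨- ((gL p - 1) * r), by linear_combination - hr⟩
    have hy : ∀ k, NL p ^ (k + 1) = (p : L p) ^ k * NL p := by
      intro k
      induction k with
      | zero => simp
      | succ k ih =>
        rw [pow_succ, ih, mul_assoc, N_mul, aug_N, map_natCast]; ring
    refine ⟨p * n + (n + 1), hmul _ ?_, hmul _ ?_⟩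
    · rw [pow_add, pow_mul]
      exact Dvd.dvd.mul_right (pow_dvd_pow_of_dvd hx n) _
    · rw [pow_add, hy]
      exact Dvd.dvd.mul_left (Dvd.intro _ rfl) _

end Concrete

/-- the number of `L`-submodules `M ⊆ L` with `|L/M| = p^n` equals
`1 + p(n−1)` for `n ≥ 2`, and equals `1` for `n = 0, 1`. -/
theorem stmt_10 (p : ℕ) [Fact p.Prime] :
    (∀ n : ℕ, 2 ≤ n →
      Nat.card {M : Submodule (L p) (L p) // Nat.card (L p ⧸ M) = p ^ n}
        = 1 + p * (n - 1)) ∧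
    Nat.card {M : Submodule (L p) (L p) // Nat.card (L p ⧸ M) = p ^ 0} = 1 ∧
    Nat.card {M : Submodule (L p) (L p) // Nat.card (L p ⧸ M) = p ^ 1} = 1 := by
  refine ⟨?_, ?_, ?_⟩
  · intro n hn
    obtain ⟨k, rfl⟩ := Nat.exists_eq_add_of_le hn
    have h := (nodeL p).count (k + 1)
    rw [show 2 + k = k + 1 + 1 by omega, h]
    rfl
  · rw [pow_zero, Nat.card_eq_one_iff_unique]
    have key : ∀ M : Submodule (L p) (L p), Nat.card (L p ⧸ M) = 1 ↔ M = ⊤ := by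
      intro M
      rw [Nat.card_eq_one_iff_unique, ← Submodule.Quotient.subsingleton_iff]
      exact ⟨fun h => h.1, fun h => ⟨h, ⟨0⟩⟩⟩
    exact ⟨⟨fun a b => Subtype.ext (((key _).1 a.2).trans ((key _).1 b.2).symm)⟩,
      ⟨⟨⊤, (key _).2 rfl⟩⟩⟩
  · have h := (nodeL p).count 0
    simpa using h
end
end
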